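/- Let p be a prime, t ≥ 2 and n ≥ 2 integers, let ω be a Dirichlet character modulo p^t with values in ℂ whose conductor is strictly smaller than p^t, and let w ∈ (ZMod (p^t))ˣ. Then Σ_{χ primitive mod p^t} χ(w)·τ(χ)·τ(χ⁻¹)^(n−1)·τ(ω⁻¹·χ⁻¹) = p^t · φ(p^t) · Σ_{(x₁,…,x_{n−1}) ∈ ((ZMod (p^t))ˣ)^(n−1), x₁·x₂⋯x_{n−1} = −w} ω(x₁)⁻¹·e_{p^t}(x₁ + x₂ + … + x_{n−1}), where the sum on the left runs over all primitive Dirichlet characters modulo p^t and φ is Euler's totient function. (This is the finite arithmetic content of the Bessel-transform computation for a generic representation of GL_n with central character ω satisfying a(ω) < a(π) ≤ t: after the stability identity ε(1/2, χ·π, ψ) = ε(1/2, ωχ, ψ)·ε(1/2, χ, ψ)^(n−1), the sum over characters of conductor exactly p^t of products of GL(1) ε-factors evaluates to a twisted (n−1)-dimensional hyper-Kloosterman sum.) -/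

import Mathlib

lemma aux_cond_dvd {p : ℕ} [hp : Fact p.Prime] {t : ℕ} (ht : 2 ≤ t)
    (χ : DirichletCharacter ℂ (p ^ t)) (h : χ.conductor ≠ p ^ t) :
    χ.conductor ∣ p ^ (t - 1) := by
  obtain ⟨k, hk, hk'⟩ := (Nat.dvd_prime_pow hp.out).1 χ.conductor_dvd_level
  rw [hk']
  apply pow_dvd_pow
  have : k ≠ t := by
    rintro rfl
    exact h hk'
  omega

lemma aux_gauss_zero {p : ℕ} [hp : Fact p.Prime] {t : ℕ} (ht : 2 ≤ t)
    (χ : DirichletCharacter ℂ (p ^ t)) (h : χ.conductor ∣ p ^ (t - 1)) :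
    gaussSum χ ZMod.stdAddChar = 0 := by
  have hdvd : p ^ (t - 1) ∣ p ^ t := pow_dvd_pow _ (by omega)
  obtain ⟨_, χ₀, hχ⟩ := (DirichletCharacter.mem_conductorSet_iff_conductor_dvd χ hdvd).2 h
  set q : ZMod (p ^ t) := ((p ^ (t - 1) : ℕ) : ZMod (p ^ t)) with hq
  have hnil : IsNilpotent q := by
    refine ⟨2, ?_⟩
    rw [hq, ← Nat.cast_pow, ZMod.natCast_eq_zero_iff, ← pow_mul]
    exact pow_dvd_pow _ (by omega)
  have hq0 : q ≠ 0 := by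
    rw [hq, Ne, ZMod.natCast_eq_zero_iff, Nat.pow_dvd_pow_iff_le_right hp.out.one_lt]
    omega
  have hunit (x : ZMod (p ^ t)) (hx : IsUnit x) : χ (x + q) = χ x := by
    have hx' : IsUnit (x + q) := by
      rw [add_comm]; exact hnil.isUnit_add_right_of_commute hx (Commute.all _ _)
    obtain ⟨u, rfl⟩ := hx
    obtain ⟨v, hv⟩ := hx'
    rw [← hv, hχ, DirichletCharacter.changeLevel_eq_cast_of_dvd,
      DirichletCharacter.changeLevel_eq_cast_of_dvd, hv, ZMod.cast_add hdvd, hq,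
      ZMod.cast_natCast hdvd]
    simp
  have hinv (x : ZMod (p ^ t)) : χ (x + q) = χ x := by
    by_cases hx : IsUnit x
    · exact hunit x hx
    · have hx' : ¬ IsUnit (x + q) := by
        intro h1
        apply hx
        have := hnil.neg.isUnit_add_right_of_commute h1 (Commute.all _ _)
        simpa using this
      rw [χ.map_nonunit hx, χ.map_nonunit hx']
  have key : gaussSum χ ZMod.stdAddChar = ZMod.stdAddChar q * gaussSum χ ZMod.stdAddChar := by
    conv_lhs => rw [gaussSum, ← Equiv.sum_comp (Equiv.addRight q)]
    rw [gaussSum, Finset.mul_sum]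
    refine Finset.sum_congr rfl fun x _ => ?_
    simp only [Equiv.coe_addRight, hinv, AddChar.map_add_eq_mul]
    ring
  by_contra hne
  have h1 : ZMod.stdAddChar q = (1 : ℂ) := by
    have := mul_right_cancel₀ hne ((one_mul _).trans key)
    exact this.symm
  apply hq0
  apply ZMod.injective_stdAddChar
  rw [h1, AddChar.map_zero_eq_one]

lemma aux_gauss_mul {N : ℕ} [NeZero N] (χ : DirichletCharacter ℂ N) (h : χ.IsPrimitive) :
    gaussSum χ ZMod.stdAddChar * gaussSum χ⁻¹ ZMod.stdAddChar = χ (-1) * N := by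
  have h1 : gaussSum χ ZMod.stdAddChar * gaussSum χ⁻¹ ZMod.stdAddChar =
      ∑ a : ZMod N, ∑ x : ZMod N, χ x * ZMod.stdAddChar (a * (x + 1)) := by
    conv_lhs => rw [mul_comm, gaussSum, Finset.sum_mul]
    refine Finset.sum_congr rfl fun a _ => ?_
    have := gaussSum_mulShift_of_isPrimitive ZMod.stdAddChar h a
    rw [mul_right_comm, ← this, gaussSum, Finset.sum_mul]
    refine Finset.sum_congr rfl fun x _ => ?_
    rw [AddChar.mulShift_apply, mul_assoc, ← AddChar.map_add_eq_mul]
    ring_nf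
  rw [h1, Finset.sum_comm]
  simp_rw [← Finset.mul_sum, AddChar.sum_mulShift _ (ZMod.isPrimitive_stdAddChar N)]
  rw [Finset.sum_eq_single (-1)]
  · simp [ZMod.card]
  · intro b _ hb
    rw [if_neg (fun hh => hb (eq_neg_of_add_eq_zero_left hh))]
    simp
  · simp

lemma aux_gauss_units {N : ℕ} [NeZero N] (χ : DirichletCharacter ℂ N) :
    gaussSum χ ZMod.stdAddChar =
      ∑ u : (ZMod N)ˣ, χ (u : ZMod N) * ZMod.stdAddChar (u : ZMod N) := by
  rw [gaussSum]
  symm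
  apply Finset.sum_of_injOn (fun u : (ZMod N)ˣ => (u : ZMod N))
  · exact fun a _ b _ hab => Units.ext hab
  · simp
  · intro x _ hx
    rw [χ.map_nonunit, zero_mul]
    rintro ⟨u, rfl⟩
    exact hx ⟨u, by simp, rfl⟩
  · simp

open scoped Classical in
lemma aux_sum {N : ℕ} [NeZero N] (m : ℕ) (ω : DirichletCharacter ℂ N) (v : (ZMod N)ˣ) :
    ∑ χ : DirichletCharacter ℂ N, χ (v : ZMod N) * (gaussSum χ⁻¹ ZMod.stdAddChar) ^ m *
        gaussSum (ω⁻¹ * χ⁻¹) ZMod.stdAddChar =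
      (Nat.totient N : ℂ) *
        ∑ x ∈ Finset.univ.filter (fun x : Fin (m + 1) → (ZMod N)ˣ => ∏ i, x i = v),
          (ω (x 0 : ZMod N))⁻¹ * ZMod.stdAddChar (∑ i, (x i : ZMod N)) := by
  have hinv (χ : DirichletCharacter ℂ N) (u : (ZMod N)ˣ) :
      χ⁻¹ (u : ZMod N) = (χ (u : ZMod N))⁻¹ := MulChar.inv_apply_eq_inv' _ _
  have hsum (x : Fin (m + 1) → (ZMod N)ˣ) :
      ZMod.stdAddChar (∑ i, (x i : ZMod N)) =
        ∏ i, (ZMod.stdAddChar (x i : ZMod N) : ℂ) := by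
    have := map_prod (AddChar.toMonoidHom (ZMod.stdAddChar (N := N)))
      (fun i => Multiplicative.ofAdd (x i : ZMod N)) Finset.univ
    exact this
  have h1 (χ : DirichletCharacter ℂ N) : (gaussSum χ⁻¹ ZMod.stdAddChar) ^ m *
        gaussSum (ω⁻¹ * χ⁻¹) ZMod.stdAddChar =
      ∑ x : Fin (m + 1) → (ZMod N)ˣ, χ ((∏ i, x i : (ZMod N)ˣ) : ZMod N)⁻¹ *
        ((ω (x 0 : ZMod N))⁻¹ * ZMod.stdAddChar (∑ i, (x i : ZMod N))) := by
    have h2 : (gaussSum χ⁻¹ ZMod.stdAddChar) ^ m * gaussSum (ω⁻¹ * χ⁻¹) ZMod.stdAddChar =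
        ∏ i : Fin (m + 1), ∑ u : (ZMod N)ˣ,
          (if i = 0 then (ω⁻¹ * χ⁻¹) else χ⁻¹) (u : ZMod N) *
            ZMod.stdAddChar (u : ZMod N) := by
      rw [Fin.prod_univ_succ, aux_gauss_units, aux_gauss_units]
      simp [mul_comm, Fin.succ_ne_zero]
    rw [h2, Finset.prod_univ_sum, Fintype.piFinset_univ]
    refine Finset.sum_congr rfl fun x _ => ?_
    rw [Finset.prod_mul_distrib, hsum, Fin.prod_univ_succ, ← mul_assoc]
    congr 1
    have h3 : χ ((∏ i, x i : (ZMod N)ˣ) : ZMod N)⁻¹ = ∏ i, (χ (x i : ZMod N))⁻¹ := by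
      rw [ZMod.inv_coe_unit, ← Ring.inverse_unit, ← MulChar.inv_apply, hinv]
      simp
    rw [h3, Fin.prod_univ_succ]
    simp [Fin.succ_ne_zero, hinv]
    ring
  simp_rw [mul_assoc, h1, Finset.mul_sum]
  rw [Finset.sum_comm, Finset.sum_filter]
  refine Finset.sum_congr rfl fun x _ => ?_
  have := DirichletCharacter.sum_char_inv_mul_char_eq ℂ (Units.isUnit (∏ i, x i)) (v : ZMod N)
  have h4 : ∑ χ : DirichletCharacter ℂ N, χ (v : ZMod N) *
      χ ((∏ i, x i : (ZMod N)ˣ) : ZMod N)⁻¹ = if ∏ i, x i = v then (N.totient : ℂ) else 0 := by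
    simp_rw [mul_comm (_ : ℂ)] at this ⊢
    simpa [Units.ext_iff, mul_comm] using this
  simp_rw [← mul_assoc, ← Finset.sum_mul]
  rw [h4]
  split_ifs <;> simp [mul_assoc]

open Finset in
open scoped Classical in
/-- Finite arithmetic content of the Bessel-transform computation for `GL_n` with central
character `ω` of conductor `< p^t`: for `t ≥ 2`, `n ≥ 2` and a unit `w` mod `p^t`,
`∑_{χ primitive mod p^t} χ(w) τ(χ) τ(χ⁻¹)^(n-1) τ(ω⁻¹χ⁻¹)
  = p^t · φ(p^t) · ∑_{x₁⋯x_{n-1} = -w} ω(x₁)⁻¹ e_{p^t}(x₁+⋯+x_{n-1})`. -/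
theorem sum_primitive_char_eps_eq_twisted_kloosterman (p : ℕ) [Fact p.Prime] (t : ℕ)
    (ht : 2 ≤ t) (n : ℕ) (hn : 2 ≤ n) (ω : DirichletCharacter ℂ (p ^ t))
    (hω : ω.conductor < p ^ t) (w : (ZMod (p ^ t))ˣ) :
    ∑ χ ∈ univ.filter (fun χ : DirichletCharacter ℂ (p ^ t) => χ.IsPrimitive),
        χ (w : ZMod (p ^ t)) * gaussSum χ ZMod.stdAddChar *
          (gaussSum χ⁻¹ ZMod.stdAddChar) ^ (n - 1) *
            gaussSum (ω⁻¹ * χ⁻¹) ZMod.stdAddChar =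
      (p : ℂ) ^ t * (Nat.totient (p ^ t) : ℂ) *
        ∑ x ∈ univ.filter (fun x : Fin (n - 1) → (ZMod (p ^ t))ˣ => ∏ i, x i = -w),
          (ω ((x ⟨0, by omega⟩ : ZMod (p ^ t))))⁻¹ *
            ZMod.stdAddChar (∑ i, (x i : ZMod (p ^ t))) := by
  obtain ⟨m, rfl⟩ : ∃ m, n = m + 2 := ⟨n - 2, by omega⟩
  have h := aux_sum m ω (-w)
  have hz (χ : DirichletCharacter ℂ (p ^ t)) (hχ : ¬ χ.IsPrimitive) :
      gaussSum (ω⁻¹ * χ⁻¹) ZMod.stdAddChar = 0 := by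
    apply aux_gauss_zero ht
    refine (DirichletCharacter.conductor_mul_dvd_lcm_conductor _ _).trans ?_
    rw [DirichletCharacter.conductor_inv, DirichletCharacter.conductor_inv]
    exact Nat.lcm_dvd (aux_cond_dvd ht ω hω.ne) (aux_cond_dvd ht χ hχ)
  refine Eq.trans ?_ ((congrArg (fun z : ℂ => (p : ℂ) ^ t * z) h).trans (mul_assoc _ _ _).symm)
  rw [Finset.mul_sum, Finset.sum_filter]
  refine Finset.sum_congr rfl fun χ _ => ?_
  split_ifs with hχ
  · have h2 := aux_gauss_mul χ hχ
    have h3 : χ ((-w : (ZMod (p ^ t))ˣ) : ZMod (p ^ t)) = χ (-1) * χ (w : ZMod (p ^ t)) := by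
      rw [← map_mul]; simp
    have h4 : m + 2 - 1 = m + 1 := rfl
    rw [h3, h4, pow_succ]
    push_cast at h2
    linear_combination χ (w : ZMod (p ^ t)) * (gaussSum χ⁻¹ ZMod.stdAddChar) ^ m *
      gaussSum (ω⁻¹ * χ⁻¹) ZMod.stdAddChar * h2
  · rw [hz χ hχ]; simp
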